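/- arXiv:2210.05509 — 2 statements merged into one kernel-verified Lean document; each statement's English description precedes it below -/
import Mathlib

section
/- Let n ≥ 1 and let A be an invertible n×n real matrix with det(A) > 0 and singular value decomposition A = U Σ Vᵀ (U, V orthogonal, Σ diagonal with positive decreasing diagonal). Then U Vᵀ ∈ SO(n), i.e., det(U Vᵀ) = 1, and consequently U Vᵀ minimizes ‖X − A‖_F over all X ∈ SO(n). -/
open Matrix BigOperators

/-- Frobenius norm of a real square matrix. -/
noncomputable def frobNorm {n : ℕ} (M : Matrix (Fin n) (Fin n) ℝ) : ℝ :=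
  Real.sqrt (∑ i, ∑ j, (M i j) ^ 2)

/-- Membership in the orthogonal group `O(n)`. -/
def IsOrth {n : ℕ} (X : Matrix (Fin n) (Fin n) ℝ) : Prop :=
  Xᵀ * X = 1 ∧ X * Xᵀ = 1

/-- Membership in the special orthogonal group `SO(n)`. -/
def IsSO {n : ℕ} (X : Matrix (Fin n) (Fin n) ℝ) : Prop :=
  Xᵀ * X = 1 ∧ X * Xᵀ = 1 ∧ X.det = 1

lemma sumsq_eq_trace {n : ℕ} (M : Matrix (Fin n) (Fin n) ℝ) :
    ∑ i, ∑ j, (M i j) ^ 2 = (Mᵀ * M).trace := by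
  rw [Finset.sum_comm]
  simp [Matrix.trace, Matrix.mul_apply, pow_two]

lemma trace_conj {n : ℕ} (U V M : Matrix (Fin n) (Fin n) ℝ) (hU : IsOrth U) (hV : IsOrth V) :
    ((U * M * Vᵀ)ᵀ * (U * M * Vᵀ)).trace = (Mᵀ * M).trace := by
  have h : (U * M * Vᵀ)ᵀ * (U * M * Vᵀ) = V * (Mᵀ * M * Vᵀ) := by
    calc (U * M * Vᵀ)ᵀ * (U * M * Vᵀ) = V * (Mᵀ * (Uᵀ * U) * M * Vᵀ) := by
          simp only [Matrix.transpose_mul, Matrix.transpose_transpose, Matrix.mul_assoc]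
      _ = _ := by rw [hU.1, Matrix.mul_one]
  rw [h, Matrix.trace_mul_comm, Matrix.mul_assoc, hV.1, Matrix.mul_one]

lemma trace_orth_sub_diag {n : ℕ} (Z : Matrix (Fin n) (Fin n) ℝ) (σ : Fin n → ℝ)
    (hZ : Zᵀ * Z = 1) :
    ((Z - Matrix.diagonal σ)ᵀ * (Z - Matrix.diagonal σ)).trace
      = (1 : Matrix (Fin n) (Fin n) ℝ).trace - 2 * ∑ i, σ i * Z i i + ∑ i, σ i * σ i := by
  have h : (Z - Matrix.diagonal σ)ᵀ * (Z - Matrix.diagonal σ)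
      = 1 - Zᵀ * Matrix.diagonal σ - Matrix.diagonal σ * Z
        + Matrix.diagonal σ * Matrix.diagonal σ := by
    rw [Matrix.transpose_sub, Matrix.diagonal_transpose, ← hZ]
    noncomm_ring
  have h1 : (Matrix.diagonal σ * Z).trace = ∑ i, σ i * Z i i := by
    simp [Matrix.trace, Matrix.diagonal_mul]
  have h2 : (Zᵀ * Matrix.diagonal σ).trace = ∑ i, σ i * Z i i := by
    simp [Matrix.trace, Matrix.mul_diagonal, mul_comm]
  have h3 : (Matrix.diagonal σ * Matrix.diagonal σ).trace = ∑ i, σ i * σ i := by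
    simp [Matrix.trace]
  rw [h, Matrix.trace_add, Matrix.trace_sub, Matrix.trace_sub, h1, h2, h3]
  ring

lemma orth_diag_le_one {n : ℕ} (Z : Matrix (Fin n) (Fin n) ℝ) (hZ : Zᵀ * Z = 1) (i : Fin n) :
    Z i i ≤ 1 := by
  have h : ∑ k, Z k i * Z k i = 1 := by
    have := congrFun (congrFun hZ i) i
    simpa [Matrix.mul_apply] using this
  have h2 : Z i i * Z i i ≤ ∑ k, Z k i * Z k i :=
    Finset.single_le_sum (f := fun k => Z k i * Z k i)
      (fun k _ => mul_self_nonneg _) (Finset.mem_univ i)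
  nlinarith

/-- For an invertible `A` with `det A > 0` and SVD `A = U Σ Vᵀ` (positive decreasing
singular values), `U Vᵀ ∈ SO(n)` and `U Vᵀ` minimizes the Frobenius distance to `A`
over `SO(n)`. -/
theorem UVt_mem_SO_and_minimizes_of_det_pos (n : ℕ) (hn : 1 ≤ n)
    (A U V : Matrix (Fin n) (Fin n) ℝ) (σ : Fin n → ℝ)
    (hA : IsUnit A) (hdet : 0 < A.det)
    (hU : IsOrth U) (hV : IsOrth V)
    (hσdec : Antitone σ) (hσpos : ∀ i, 0 < σ i)
    (hSVD : A = U * Matrix.diagonal σ * Vᵀ) :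
    IsSO (U * Vᵀ) ∧
    ∀ X : Matrix (Fin n) (Fin n) ℝ, IsSO X →
      frobNorm (U * Vᵀ - A) ≤ frobNorm (X - A) := by
  have hO1 : (U * Vᵀ)ᵀ * (U * Vᵀ) = 1 := by
    calc (U * Vᵀ)ᵀ * (U * Vᵀ) = V * ((Uᵀ * U) * Vᵀ) := by
          simp only [Matrix.transpose_mul, Matrix.transpose_transpose, Matrix.mul_assoc]
      _ = 1 := by rw [hU.1, Matrix.one_mul, hV.2]
  have hO2 : (U * Vᵀ) * (U * Vᵀ)ᵀ = 1 := mul_eq_one_comm.mp hO1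
  refine ⟨⟨hO1, hO2, ?_⟩, ?_⟩
  · have hsq : (U * Vᵀ).det * (U * Vᵀ).det = 1 := by
      have := congrArg Matrix.det hO1
      rwa [Matrix.det_mul, Matrix.det_transpose, Matrix.det_one] at this
    have hp : 0 < ∏ i, σ i := Finset.prod_pos fun i _ => hσpos i
    have hd : A.det = (U * Vᵀ).det * ∏ i, σ i := by
      rw [hSVD, Matrix.det_mul, Matrix.det_mul, Matrix.det_mul, Matrix.det_diagonal]
      ring
    rw [hd] at hdet
    have hpos : 0 < (U * Vᵀ).det := pos_of_mul_pos_left hdet hp.le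
    nlinarith
  · intro X hX
    unfold frobNorm
    apply Real.sqrt_le_sqrt
    rw [sumsq_eq_trace, sumsq_eq_trace]
    have e1 : U * Vᵀ - A = U * (1 - Matrix.diagonal σ) * Vᵀ := by
      rw [hSVD]; noncomm_ring
    have e2 : X - A = U * (Uᵀ * X * V - Matrix.diagonal σ) * Vᵀ := by
      have : X = U * (Uᵀ * X * V) * Vᵀ := by
        calc X = (U * Uᵀ) * X * (V * Vᵀ) := by rw [hU.2, hV.2, Matrix.one_mul, Matrix.mul_one]
          _ = _ := by simp only [Matrix.mul_assoc]
      rw [Matrix.mul_sub, Matrix.sub_mul, ← this, hSVD]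
    have hY : (Uᵀ * X * V)ᵀ * (Uᵀ * X * V) = 1 := by
      calc (Uᵀ * X * V)ᵀ * (Uᵀ * X * V) = Vᵀ * (Xᵀ * ((U * Uᵀ) * (X * V))) := by
            simp only [Matrix.transpose_mul, Matrix.transpose_transpose, Matrix.mul_assoc]
        _ = 1 := by
            rw [hU.2, Matrix.one_mul, ← Matrix.mul_assoc Xᵀ, hX.1, Matrix.one_mul, hV.1]
    rw [e1, e2, trace_conj U V _ hU hV, trace_conj U V _ hU hV,
      trace_orth_sub_diag _ σ (by simp), trace_orth_sub_diag _ σ hY]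
    have : ∑ i, σ i * (Uᵀ * X * V) i i ≤ ∑ i, σ i * (1 : Matrix (Fin n) (Fin n) ℝ) i i := by
      apply Finset.sum_le_sum
      intro i _
      rw [Matrix.one_apply_eq]
      exact mul_le_mul_of_nonneg_left (orth_diag_le_one _ hY i) (hσpos i).le
    linarith
end

section
/- Let n ≥ 1 and let A be an invertible n×n real matrix with det(A) < 0 and singular values σ₁ ≥ σ₂ ≥ … ≥ σₙ > 0. Then the minimum of ‖X − A‖_F² over X ∈ SO(n) equals ∑ᵢ₌₁^{n−1} (σᵢ − 1)² + (σₙ + 1)². -/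
open Matrix BigOperators

lemma frobNorm_sq_eq {n : ℕ} (M : Matrix (Fin n) (Fin n) ℝ) :
    frobNorm M ^ 2 = (Mᵀ * M).trace := by
  unfold frobNorm
  have h : 0 ≤ ∑ i, ∑ j, (M i j) ^ 2 :=
    Finset.sum_nonneg fun i _ => Finset.sum_nonneg fun j _ => sq_nonneg _
  rw [Real.sq_sqrt h, Finset.sum_comm]
  simp [Matrix.trace, Matrix.mul_apply, sq]

lemma frob_invariant {n : ℕ} (U V M : Matrix (Fin n) (Fin n) ℝ) (hU : IsOrth U)
    (hV : IsOrth V) : frobNorm (U * M * Vᵀ) ^ 2 = frobNorm M ^ 2 := by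
  rw [frobNorm_sq_eq, frobNorm_sq_eq]
  have h : (U * M * Vᵀ)ᵀ * (U * M * Vᵀ) = V * (Mᵀ * M * Vᵀ) := by
    simp only [Matrix.transpose_mul, Matrix.transpose_transpose]
    calc V * (Mᵀ * Uᵀ) * (U * M * Vᵀ) = V * (Mᵀ * (Uᵀ * U) * M * Vᵀ) := by
          simp only [Matrix.mul_assoc]
      _ = _ := by rw [hU.1, Matrix.mul_one]
  rw [h, Matrix.trace_mul_comm, Matrix.mul_assoc, hV.1, Matrix.mul_one]

lemma orth_diag_le {n : ℕ} (Y : Matrix (Fin n) (Fin n) ℝ) (hY : Yᵀ * Y = 1) (i : Fin n) :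
    Y i i ≤ 1 := by
  have h := congrFun (congrFun hY i) i
  simp only [Matrix.mul_apply, Matrix.transpose_apply, Matrix.one_apply_eq] at h
  have h2 : Y i i * Y i i ≤ ∑ j, Y j i * Y j i :=
    Finset.single_le_sum (f := fun j => Y j i * Y j i) (fun j _ => mul_self_nonneg _)
      (Finset.mem_univ i)
  nlinarith

lemma trace_le_of_det_neg {n : ℕ} (Y : Matrix (Fin n) (Fin n) ℝ) (hY : Yᵀ * Y = 1)
    (hd : Y.det = -1) : Y.trace ≤ n - 2 := by
  have hY2 : Y * Yᵀ = 1 := mul_eq_one_comm.mp hY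
  have h0 : (Y + 1).det = 0 := by
    have h : Y + 1 = Y * (Y + 1)ᵀ := by
      rw [Matrix.transpose_add, Matrix.mul_add, hY2, Matrix.transpose_one, Matrix.mul_one,
        add_comm]
    have h' := congrArg Matrix.det h
    rw [Matrix.det_mul, Matrix.det_transpose, hd] at h'
    linarith
  obtain ⟨v, hv, hYv⟩ := Matrix.exists_mulVec_eq_zero_iff.mpr h0
  rw [Matrix.add_mulVec, Matrix.one_mulVec] at hYv
  have hYv' : Y *ᵥ v = -v := eq_neg_of_add_eq_zero_left hYv
  have hs : v ⬝ᵥ v ≠ 0 := fun h => hv (dotProduct_self_eq_zero.mp h)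
  set s := v ⬝ᵥ v with hsdef
  set R : Matrix (Fin n) (Fin n) ℝ := 1 - (2 / s) • vecMulVec v v with hR
  have hRt : Rᵀ = R := by
    simp [hR, Matrix.transpose_sub, Matrix.transpose_smul, Matrix.transpose_vecMulVec]
  have hvv : vecMulVec v v * vecMulVec v v = s • vecMulVec v v := by
    rw [Matrix.vecMulVec_mul_vecMulVec, hsdef]
    ext i j
    simp [vecMulVec_apply, mul_comm, mul_left_comm]
  have hRR : R * R = 1 := by
    rw [hR]
    simp only [sub_mul, mul_sub, one_mul, mul_one, Matrix.smul_mul, Matrix.mul_smul, hvv,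
      smul_smul]
    rw [show 2 / s * (2 / s * s) = 2 / s + 2 / s by field_simp; norm_num, add_smul]
    abel
  have hZ : (Y * R)ᵀ * (Y * R) = 1 := by
    rw [Matrix.transpose_mul, hRt]
    calc R * Yᵀ * (Y * R) = R * (Yᵀ * Y) * R := by simp only [Matrix.mul_assoc]
      _ = 1 := by rw [hY, Matrix.mul_one, hRR]
  have hle : (Y * R).trace ≤ n := by
    calc (Y * R).trace ≤ ∑ _i : Fin n, (1 : ℝ) :=
          Finset.sum_le_sum fun i _ => orth_diag_le _ hZ i
      _ = n := by simp
  have ht : (Y * R).trace = Y.trace + 2 := by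
    rw [hR, Matrix.mul_sub, Matrix.mul_one, Matrix.mul_smul, Matrix.mul_vecMulVec, hYv',
      Matrix.trace_sub, Matrix.trace_smul, Matrix.trace_vecMulVec, neg_dotProduct, ← hsdef,
      smul_eq_mul]
    field_simp
    ring
  linarith

lemma frob_sub_diag {n : ℕ} (Y : Matrix (Fin n) (Fin n) ℝ) (hY : Yᵀ * Y = 1)
    (σ : Fin n → ℝ) :
    frobNorm (Y - Matrix.diagonal σ) ^ 2 = ∑ i, (1 + σ i ^ 2 - 2 * (σ i * Y i i)) := by
  rw [frobNorm_sq_eq, Matrix.transpose_sub, Matrix.diagonal_transpose, Matrix.sub_mul,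
    Matrix.mul_sub, Matrix.mul_sub, hY]
  simp only [Matrix.trace, Matrix.diag_apply, Matrix.sub_apply, Matrix.one_apply_eq,
    Matrix.mul_diagonal, Matrix.diagonal_mul, Matrix.transpose_apply, Matrix.diagonal_apply_eq]
  refine Finset.sum_congr rfl fun i _ => ?_
  ring

/-- For an invertible `A` with `det A < 0` and singular values `σ₁ ≥ ⋯ ≥ σₙ > 0`
(expressed via an SVD `A = U Σ Vᵀ`), the minimum of `‖X − A‖_F²` over `X ∈ SO(n)`
equals `∑_{i<n} (σᵢ − 1)² + (σₙ + 1)²`. -/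
theorem min_frobSq_over_SO_of_det_neg (n : ℕ) (hn : 1 ≤ n)
    (A U V : Matrix (Fin n) (Fin n) ℝ) (σ : Fin n → ℝ)
    (hA : IsUnit A) (hdet : A.det < 0)
    (hU : IsOrth U) (hV : IsOrth V)
    (hσdec : Antitone σ) (hσpos : ∀ i, 0 < σ i)
    (hSVD : A = U * Matrix.diagonal σ * Vᵀ) :
    IsLeast {c : ℝ | ∃ X : Matrix (Fin n) (Fin n) ℝ, IsSO X ∧ c = frobNorm (X - A) ^ 2}
      ((∑ i ∈ Finset.univ.filter (fun i : Fin n => (i : ℕ) < n - 1), (σ i - 1) ^ 2)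
        + (σ ⟨n - 1, by omega⟩ + 1) ^ 2) := by
  set l : Fin n := ⟨n - 1, by omega⟩ with hl
  set d : Fin n → ℝ := fun i => if i = l then -1 else 1 with hd
  have hdd : ∀ i, d i * d i = 1 := fun i => by simp only [hd]; split_ifs <;> norm_num
  have hval : (∑ i ∈ Finset.univ.filter (fun i : Fin n => (i : ℕ) < n - 1), (σ i - 1) ^ 2)
        + (σ l + 1) ^ 2 = ∑ i, (1 + σ i ^ 2 - 2 * (σ i * d i)) := by
    have hf : Finset.univ.filter (fun i : Fin n => (i : ℕ) < n - 1) = Finset.univ.erase l := by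
      ext i
      simp only [Finset.mem_filter, Finset.mem_univ, true_and, Finset.mem_erase, and_true,
        ne_eq, hl, Fin.ext_iff]
      omega
    rw [hf, ← Finset.sum_erase_add _ _ (Finset.mem_univ l)]
    congr 1
    · refine Finset.sum_congr rfl fun i hi => ?_
      simp only [hd, if_neg (Finset.ne_of_mem_erase hi)]
      ring
    · simp only [hd, if_true]
      ring
  have hdetd : (Matrix.diagonal d).det = -1 := by
    rw [Matrix.det_diagonal, Finset.prod_ite_eq' Finset.univ l (fun _ => (-1 : ℝ))]
    simp
  have hsumd : ∑ i, d i = n - 2 := by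
    have : ∀ i, d i = 1 - (if i = l then 2 else 0) := fun i => by
      simp only [hd]; split_ifs <;> norm_num
    simp only [this, Finset.sum_sub_distrib]
    simp
  have hUd : U.det * U.det = 1 := by
    have := congrArg Matrix.det hU.1
    simpa using this
  have hVd : V.det * V.det = 1 := by
    have := congrArg Matrix.det hV.1
    simpa using this
  have hUV : U.det * V.det = -1 := by
    have hp : 0 < ∏ i, σ i := Finset.prod_pos fun i _ => hσpos i
    rw [hSVD, Matrix.det_mul, Matrix.det_mul, Matrix.det_diagonal, Matrix.det_transpose] at hdet
    have hneg : U.det * V.det < 0 := by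
      by_contra hc
      push Not at hc
      have := mul_nonneg hc hp.le
      nlinarith
    have hsq : (U.det * V.det - 1) * (U.det * V.det + 1) = 0 := by
      have : (U.det * V.det) * (U.det * V.det) = 1 := by
        calc _ = (U.det * U.det) * (V.det * V.det) := by ring
          _ = 1 := by rw [hUd, hVd, one_mul]
      linarith
    rcases mul_eq_zero.mp hsq with h | h <;> linarith
  have hDD : (Matrix.diagonal d)ᵀ * Matrix.diagonal d = 1 := by
    rw [Matrix.diagonal_transpose, Matrix.diagonal_mul_diagonal]
    simp only [hdd, Matrix.diagonal_one]
  rw [hval]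
  constructor
  · refine ⟨U * Matrix.diagonal d * Vᵀ, ?_, ?_⟩
    · have h1 : (U * Matrix.diagonal d * Vᵀ)ᵀ * (U * Matrix.diagonal d * Vᵀ) = 1 := by
        rw [Matrix.transpose_mul, Matrix.transpose_mul, Matrix.transpose_transpose]
        calc V * ((Matrix.diagonal d)ᵀ * Uᵀ) * (U * Matrix.diagonal d * Vᵀ)
            = V * ((Matrix.diagonal d)ᵀ * (Uᵀ * U) * Matrix.diagonal d) * Vᵀ := by
              simp only [Matrix.mul_assoc]
          _ = 1 := by rw [hU.1, Matrix.mul_one, hDD, Matrix.mul_one, hV.2]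
      refine ⟨h1, mul_eq_one_comm.mp h1, ?_⟩
      rw [Matrix.det_mul, Matrix.det_mul, hdetd, Matrix.det_transpose]
      linarith
    · rw [hSVD, ← Matrix.sub_mul, ← Matrix.mul_sub, frob_invariant _ _ _ hU hV,
        frob_sub_diag _ hDD]
      simp
  · rintro c ⟨X, hX, rfl⟩
    set Y := Uᵀ * X * V with hYdef
    have hXY : X = U * Y * Vᵀ := by
      calc X = (U * Uᵀ) * X * (V * Vᵀ) := by rw [hU.2, hV.2, Matrix.one_mul, Matrix.mul_one]
        _ = _ := by simp only [hYdef, Matrix.mul_assoc]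
    have hY : Yᵀ * Y = 1 := by
      rw [hYdef, Matrix.transpose_mul, Matrix.transpose_mul, Matrix.transpose_transpose]
      calc Vᵀ * (Xᵀ * U) * (Uᵀ * X * V) = Vᵀ * (Xᵀ * (U * Uᵀ) * X) * V := by
            simp only [Matrix.mul_assoc]
        _ = 1 := by rw [hU.2, Matrix.mul_one, hX.1, Matrix.mul_one, hV.1]
    have hYd : Y.det = -1 := by
      rw [hYdef, Matrix.det_mul, Matrix.det_mul, hX.2.2, Matrix.det_transpose, mul_one, hUV]
    have htr := trace_le_of_det_neg Y hY hYd
    have hfr : frobNorm (X - A) ^ 2 = ∑ i, (1 + σ i ^ 2 - 2 * (σ i * Y i i)) := by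
      rw [hSVD, hXY, ← Matrix.sub_mul, ← Matrix.mul_sub, frob_invariant _ _ _ hU hV,
        frob_sub_diag _ hY]
    rw [hfr, ← sub_nonneg, ← Finset.sum_sub_distrib]
    have hterm : ∀ i, 2 * (σ l * (d i - Y i i)) ≤
        (1 + σ i ^ 2 - 2 * (σ i * Y i i)) - (1 + σ i ^ 2 - 2 * (σ i * d i)) := by
      intro i
      by_cases hi : i = l
      · subst hi
        linarith
      · have h1 : d i = 1 := by simp only [hd, if_neg hi]
        have h2 := orth_diag_le Y hY i
        have h3 : σ l ≤ σ i := hσdec (by rw [Fin.le_def]; have := i.2; simp only [hl]; omega)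
        rw [h1]
        nlinarith [mul_nonneg (sub_nonneg.mpr h3) (sub_nonneg.mpr h2)]
    refine le_trans ?_ (Finset.sum_le_sum fun i _ => hterm i)
    rw [← Finset.mul_sum, ← Finset.mul_sum, Finset.sum_sub_distrib, hsumd]
    have hp := hσpos l
    have : Y.trace = ∑ i, Y i i := rfl
    rw [← this]
    have := mul_nonneg hp.le (sub_nonneg.mpr htr)
    linarith
end
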